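/- Let (P, α) be a maximal (p,q)-pair of rank 2 with p > 3. Then either P is an elementary abelian group of order p^2, or P is a non-abelian group of order p^3 and exponent p (i.e., an extraspecial group of order p^3 and exponent p). -/

import Mathlib

/-- The minimal number of generators of a group. -/
noncomputable def dG (G : Type*) [Group G] : ℕ :=
  sInf {n | ∃ S : Finset G, S.card = n ∧ Subgroup.closure (S : Set G) = ⊤}

/-- A maximal `(p,q)`-pair of rank `d`. -/
def IsMaximalPair (p q d : ℕ) (P : Type*) [Group P] (α : P ≃* P) : Prop :=
  p.Prime ∧ q.Prime ∧ Finite P ∧ IsPGroup p P ∧ orderOf α = q ∧ q ∣ p - 1 ∧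
  dG P = d ∧ (∀ H : Subgroup P, dG H ≤ d) ∧
  (∃ k : ℤ, ¬ ((p : ℤ) ∣ k - 1) ∧ ∀ x : P, α x * (x ^ k)⁻¹ ∈ frattini P) ∧
  (∀ H : Subgroup P, H ≠ ⊤ → dG H = d →
    H.map α.toMonoidHom ≠ H ∨
      ¬ ∃ k : ℤ, ¬ ((p : ℤ) ∣ k - 1) ∧
        ∀ x : H, α (x : P) * ((x : P) ^ k)⁻¹ ∈ (frattini H).map H.subtype)


open scoped commutatorElement

set_option linter.style.haveILetI false

open Subgroup in
theorem card_le_of_pair {Q : Type*} [CommGroup Q] (p : ℕ) (hp : p.Prime) (hexp : ∀ x : Q, x ^ p = 1)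
    (a b : Q) (hab : closure {a, b} = ⊤) : Nat.card Q ≤ p ^ 2 := by
  have : NeZero p := ⟨hp.ne_zero⟩
  have red : ∀ (x : Q) (m : ℤ), ∃ i : Fin p, x ^ m = x ^ (i : ℕ) := by
    intro x m
    have hpos : (0 : ℤ) < p := by exact_mod_cast hp.pos
    refine ⟨⟨(m % p).toNat, ?_⟩, ?_⟩
    · have := Int.emod_lt_of_pos m hpos
      have := Int.emod_nonneg m hpos.ne'
      omega
    · have h0 := Int.emod_nonneg m hpos.ne'
      rw [← zpow_natCast, Int.toNat_of_nonneg h0]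
      conv_lhs => rw [← Int.emod_add_mul_ediv m p, zpow_add, zpow_mul, zpow_natCast, hexp, one_zpow, mul_one]
  have hs : Function.Surjective (fun t : Fin p × Fin p => a ^ (t.1 : ℕ) * b ^ (t.2 : ℕ)) := by
    intro z
    have hz : z ∈ closure {a, b} := hab ▸ mem_top z
    obtain ⟨m, n, rfl⟩ := mem_closure_pair.1 hz
    obtain ⟨i, hi⟩ := red a m
    obtain ⟨j, hj⟩ := red b n
    exact ⟨(i, j), by simp [hi, hj]⟩
  have := Nat.card_le_card_of_surjective _ hs
  simpa [sq] using this

/-- every subgroup is generated by two elements -/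
def TwoGen (G : Type*) [Group G] : Prop :=
  ∀ H : Subgroup G, ∃ a b : G, H = Subgroup.closure {a, b}

theorem mem_normal_of_comm {G : Type*} [Group G] (N : Subgroup G)
    (h : ∀ x y : G, ⁅x, y⁆ ∈ N) : N.Normal := by
  refine ⟨fun n hn g => ?_⟩
  have := N.mul_mem (h g n) hn
  simpa [commutatorElement_def, mul_assoc] using this

open Subgroup in
theorem relIndex_le {G : Type*} [Group G] (h2 : TwoGen G) (p : ℕ) (hp : p.Prime)
    (N H : Subgroup G) (hpow : ∀ x ∈ H, x ^ p ∈ N)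
    (hcomm : ∀ x ∈ H, ∀ y ∈ H, ⁅x, y⁆ ∈ N) : N.relIndex H ≤ p ^ 2 := by
  have hc' : ∀ x y : H, ⁅x, y⁆ ∈ N.subgroupOf H := by
    intro x y
    rw [mem_subgroupOf]
    exact hcomm x x.2 y y.2
  have hn : (N.subgroupOf H).Normal := mem_normal_of_comm _ hc'
  obtain ⟨a, b, hab⟩ := h2 H
  have ha : a ∈ H := hab ▸ subset_closure (by simp)
  have hb : b ∈ H := hab ▸ subset_closure (by simp)
  let Q := H ⧸ N.subgroupOf H
  let π : H →* Q := QuotientGroup.mk' _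
  have hπ : Function.Surjective π := QuotientGroup.mk'_surjective _
  letI : CommGroup Q := { (inferInstance : Group Q) with
    mul_comm := by
      intro x y
      obtain ⟨x, rfl⟩ := hπ x
      obtain ⟨y, rfl⟩ := hπ y
      rw [← commutatorElement_eq_one_iff_mul_comm, ← map_commutatorElement]
      exact (QuotientGroup.eq_one_iff _).2 (hc' x y) }
  have hcl : closure {(⟨a, ha⟩ : H), ⟨b, hb⟩} = ⊤ := by
    apply map_injective H.subtype_injective
    rw [MonoidHom.map_closure]
    simp [Set.image_pair, ← hab, ← MonoidHom.range_eq_map]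
  have hcl2 : closure {π ⟨a, ha⟩, π ⟨b, hb⟩} = ⊤ := by
    rw [← Set.image_pair, ← MonoidHom.map_closure, hcl, ← MonoidHom.range_eq_map]
    exact MonoidHom.range_eq_top.2 hπ
  refine card_le_of_pair p hp ?_ _ _ hcl2
  intro x
  obtain ⟨x, rfl⟩ := hπ x
  rw [← map_pow]
  exact (QuotientGroup.eq_one_iff _).2 (mem_subgroupOf.2 (hpow x x.2))

theorem trick {Q : Type*} [CommGroup Q] (β : Q →* Q) (p : ℕ) (hp : p.Prime)
    (hexp : ∀ x : Q, x ^ p = 1) (k : ℤ) (x f : Q) (hx : β x = x ^ k * f) (hf : β f = f ^ k)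
    (hβ : β^[p] x = β x) : f = 1 := by
  have hz : ∀ (y : Q) (m : ℤ), y ^ (p * m) = 1 := by
    intro y m
    rw [zpow_mul, zpow_natCast, hexp, one_zpow]
  have key : ∀ j : ℕ, β^[j + 1] x = x ^ (k ^ (j + 1)) * f ^ ((j + 1 : ℕ) * k ^ j) := by
    intro j
    induction j with
    | zero => simp [hx]
    | succ j ih =>
      rw [Function.iterate_succ_apply', ih, map_mul, map_zpow, map_zpow, hx, hf, mul_zpow,
        ← zpow_mul, ← zpow_mul, mul_assoc, ← zpow_add]
      congr 2
      · ring
      · push_cast; ring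
  obtain ⟨j, hj⟩ : ∃ j, p = j + 1 := ⟨p - 1, (Nat.sub_add_cancel hp.one_le).symm⟩
  have h1 := key j
  rw [← hj, hβ, hx, hz, mul_one] at h1
  haveI := Fact.mk hp
  have hd : (p : ℤ) ∣ k ^ p - k := by
    rw [← ZMod.intCast_zmod_eq_zero_iff_dvd]
    simp [ZMod.pow_card]
  obtain ⟨m, hm⟩ := hd
  have h2 : k ^ p = k + p * m := by linarith
  rw [h2, zpow_add, hz] at h1
  exact mul_left_cancel h1

theorem coatom_props {G : Type*} [Group G] [Finite G] (p : ℕ) (hp : p.Prime) (hG : IsPGroup p G)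
    (K : Subgroup G) (hK : IsCoatom K) : (∀ x : G, x ^ p ∈ K) ∧ ∀ x y : G, ⁅x, y⁆ ∈ K := by
  haveI := Fact.mk hp
  haveI : Group.IsNilpotent G := hG.isNilpotent
  have hn : K.Normal := Subgroup.NormalizerCondition.normal_of_coatom K
    Group.normalizerCondition_of_isNilpotent hK
  have hidx : K.index = p := by
    obtain ⟨n, hn⟩ := IsPGroup.iff_card.1 hG
    obtain ⟨m, hm⟩ := IsPGroup.iff_card.1 (hG.to_subgroup K)
    have hlt : Nat.card K < Nat.card G := by
      apply lt_of_le_of_ne (Subgroup.card_le_card_group K)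
      intro h
      exact hK.1 (Subgroup.eq_top_of_card_eq K h)
    rw [hn, hm] at hlt
    have hmn : m < n := (Nat.pow_lt_pow_iff_right hp.one_lt).1 hlt
    obtain ⟨L, hL, hKL⟩ := Sylow.exists_subgroup_card_pow_succ (p := p) (n := m)
      (by rw [hn]; exact pow_dvd_pow p hmn) hm
    have : K < L := lt_of_le_of_ne hKL (by
      rintro rfl
      rw [hm] at hL
      have := Nat.pow_right_injective hp.two_le hL
      omega)
    have hT := hK.2 L this
    have h1 := K.card_mul_index
    rw [hT, Subgroup.card_top] at hL
    rw [hL, hm, pow_succ] at h1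
    exact Nat.eq_of_mul_eq_mul_left (pow_pos hp.pos m) h1
  have hc : Nat.card (G ⧸ K) = p := hidx
  constructor
  · intro x
    rw [← QuotientGroup.eq_one_iff, QuotientGroup.mk_pow, ← hc]
    exact pow_card_eq_one'
  · intro x y
    haveI : IsCyclic (G ⧸ K) := isCyclic_of_prime_card hc
    rw [← QuotientGroup.eq_one_iff]
    change QuotientGroup.mk' K ⁅x, y⁆ = 1
    rw [map_commutatorElement, commutatorElement_eq_one_iff_mul_comm]
    exact IsCyclic.commGroup.mul_comm _ _

theorem frattini_le_of {G : Type*} [Group G] [Finite G] (p : ℕ) (hp : p.Prime)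
    (F : Subgroup G) (hpow : ∀ x : G, x ^ p ∈ F) (hcomm : ∀ x y : G, ⁅x, y⁆ ∈ F) :
    frattini G ≤ F := by
  intro g hg
  by_contra hgF
  obtain ⟨K, hFK, hK⟩ := Set.Finite.exists_le_maximal
    (Set.toFinite {K : Subgroup G | F ≤ K ∧ g ∉ K}) (a := F) ⟨le_rfl, hgF⟩
  have hFK := hK.prop.1
  have hgK := hK.prop.2
  have hKn : ∀ L : Subgroup G, F ≤ L → L.Normal := fun L hL =>
    mem_normal_of_comm L fun x y => hL (hcomm x y)
  have hco : IsCoatom K := by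
    refine ⟨fun h => hgK (h ▸ Subgroup.mem_top g), ?_⟩
    intro L hKL
    rw [eq_top_iff]
    intro y _
    by_contra hyL
    have hgL : g ∈ L := by
      by_contra h
      exact hKL.not_ge (hK.2 ⟨hFK.trans hKL.le, h⟩ hKL.le)
    haveI := hKn K hFK
    have hKy : g ∈ K ⊔ Subgroup.zpowers y := by
      by_contra h
      have hle := hK.2 (y := K ⊔ Subgroup.zpowers y) ⟨hFK.trans le_sup_left, h⟩ le_sup_left
      exact hyL (hKL.le (hle (Subgroup.mem_sup_right (Subgroup.mem_zpowers y))))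
    obtain ⟨κ, hκ, z, hz, hgz⟩ := Subgroup.mem_sup_of_normal_left.1 hKy
    obtain ⟨i, rfl⟩ := Subgroup.mem_zpowers_iff.1 hz
    have hyi : y ^ i ∈ L := by
      have : y ^ i = κ⁻¹ * g := by rw [← hgz]; group
      rw [this]
      exact L.mul_mem (L.inv_mem (hKL.le hκ)) hgL
    have hyp : y ^ (p : ℤ) ∈ K := by rw [zpow_natCast]; exact hFK (hpow y)
    have hni : ¬ (p : ℤ) ∣ i := by
      rintro ⟨j, rfl⟩
      apply hgK
      rw [← hgz, zpow_mul]
      exact K.mul_mem hκ (K.zpow_mem hyp j)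
    have hcop : IsCoprime (p : ℤ) i := (Nat.prime_iff_prime_int.1 hp).coprime_iff_not_dvd.2 hni
    obtain ⟨u, v, huv⟩ := hcop
    apply hyL
    have : y = (y ^ (p : ℤ)) ^ u * (y ^ i) ^ v := by
      rw [← zpow_mul, ← zpow_mul, ← zpow_add]
      conv_lhs => rw [← zpow_one y, ← huv]
      congr 1; ring
    rw [this]
    exact L.mul_mem (L.zpow_mem (hKL.le hyp) u) (L.zpow_mem hyi v)
  exact hgK (frattini_le_coatom hco hg)

/-- there is no proper section on which the automorphism is a scalar on a rank two quotient -/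
def NoScalar (p : ℕ) (k : ℤ) {G : Type*} [Group G] (β : G →* G) : Prop :=
  ∀ N F H : Subgroup G, N ≤ F → F ≤ H → H ≠ ⊤ → N.relIndex H = p ^ 2 →
    (∀ x ∈ H, x ^ p ∈ N) → (∀ x ∈ H, ∀ y ∈ H, ⁅x, y⁆ ∈ N) →
    (∀ x ∈ H, β x * (x ^ k)⁻¹ ∈ F) → (∀ x ∈ F, β x * (x ^ k)⁻¹ ∈ N) → False

open Subgroup in
theorem scalar_of_chain {G : Type*} [Group G] (β : G →* G) (p : ℕ) (hp : p.Prime) (k : ℤ)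
    (hβ : ∀ x, β^[p] x = β x) (N F H : Subgroup G) (hNF : N ≤ F) (hFH : F ≤ H)
    (hpow : ∀ x ∈ H, x ^ p ∈ N) (hcomm : ∀ x ∈ H, ∀ y ∈ H, ⁅x, y⁆ ∈ N)
    (hH : ∀ x ∈ H, β x * (x ^ k)⁻¹ ∈ F) (hF : ∀ x ∈ F, β x * (x ^ k)⁻¹ ∈ N) :
    ∀ x ∈ H, β x * (x ^ k)⁻¹ ∈ N := by
  have hc' : ∀ x y : H, ⁅x, y⁆ ∈ N.subgroupOf H := by
    intro x y
    rw [mem_subgroupOf]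
    exact hcomm x x.2 y y.2
  have hn : (N.subgroupOf H).Normal := mem_normal_of_comm _ hc'
  let Q := H ⧸ N.subgroupOf H
  let π : H →* Q := QuotientGroup.mk' _
  have hπ : Function.Surjective π := QuotientGroup.mk'_surjective _
  letI : CommGroup Q := { (inferInstance : Group Q) with
    mul_comm := by
      intro x y
      obtain ⟨x, rfl⟩ := hπ x
      obtain ⟨y, rfl⟩ := hπ y
      rw [← commutatorElement_eq_one_iff_mul_comm, ← map_commutatorElement]
      exact (QuotientGroup.eq_one_iff _).2 (hc' x y) }
  have hβH : ∀ x ∈ H, β x ∈ H := by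
    intro x hx
    have := H.mul_mem (hFH (hH x hx)) (H.zpow_mem hx k)
    simpa using this
  have hβN : ∀ x ∈ N, β x ∈ N := by
    intro x hx
    have := N.mul_mem (hF x (hNF hx)) (N.zpow_mem hx k)
    simpa using this
  let βH : H →* H := (β.comp H.subtype).codRestrict H (fun x => hβH x x.2)
  have hβHc : ∀ x : H, ((βH x : H) : G) = β x := fun x => rfl
  let βQ : Q →* Q := QuotientGroup.map _ _ βH (by
    intro x hx
    rw [mem_subgroupOf] at hx
    exact mem_subgroupOf.2 (hβN x hx))
  have hβQ : ∀ x : H, βQ (π x) = π (βH x) := fun x => rfl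
  have hker : ∀ x : H, π x = 1 ↔ (x : G) ∈ N := fun x =>
    (QuotientGroup.eq_one_iff _).trans mem_subgroupOf
  have hit : ∀ (n : ℕ) (x : H), βQ^[n] (π x) = π (βH^[n] x) ∧ ((βH^[n] x : H) : G) = β^[n] x := by
    intro n
    induction n with
    | zero => intro x; exact ⟨rfl, rfl⟩
    | succ n ih =>
      intro x
      simp only [Function.iterate_succ_apply]
      rw [hβQ, (ih (βH x)).1, (ih (βH x)).2, hβHc]
      exact ⟨rfl, rfl⟩
  intro x hx
  have hfH : β x * (x ^ k)⁻¹ ∈ H := hFH (hH x hx)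
  have := trick βQ p hp (by
      intro y
      obtain ⟨y, rfl⟩ := hπ y
      rw [← map_pow, hker]
      exact hpow y y.2) k (π ⟨x, hx⟩) (π ⟨_, hfH⟩) (by
      rw [hβQ, mul_comm, ← map_zpow, ← map_mul]
      congr 1
      apply Subtype.ext
      simp [hβHc]) (by
      rw [hβQ, ← mul_inv_eq_one, ← map_zpow, ← map_inv, ← map_mul, hker]
      exact hF _ (hH x hx)) (by
      rw [(hit p _).1, hβQ]
      congr 1
      apply Subtype.ext
      rw [(hit p _).2]
      exact hβ x)
  exact (hker _).1 this

open Subgroup in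
theorem dG_pair {G : Type*} [Group G] [Finite G] (h : dG G ≤ 2) : ∃ a b : G, closure {a, b} = ⊤ := by
  classical
  have hne : {n | ∃ S : Finset G, S.card = n ∧ closure (S : Set G) = ⊤}.Nonempty := by
    haveI := Fintype.ofFinite G
    exact ⟨_, Finset.univ, rfl, by simp⟩
  obtain ⟨S, hS, hcl⟩ := Nat.sInf_mem hne
  have hS2 : S.card ≤ 2 := by rw [hS]; exact h
  interval_cases hc : S.card
  · rw [Finset.card_eq_zero] at hc
    refine ⟨1, 1, ?_⟩
    rw [eq_top_iff, ← hcl, hc]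
    exact closure_mono (by simp)
  · obtain ⟨a, ha⟩ := Finset.card_eq_one.1 hc
    exact ⟨a, a, by rw [← hcl, ha]; simp⟩
  · obtain ⟨a, b, _, ha⟩ := Finset.card_eq_two.1 hc
    exact ⟨a, b, by rw [← hcl, ha]; simp⟩

open Subgroup in
theorem dG_le_one {G : Type*} [Group G] (a : G) (h : zpowers a = ⊤) : dG G ≤ 1 := by
  apply Nat.sInf_le
  exact ⟨{a}, by simp, by simpa [zpowers_eq_closure] using h⟩

open Subgroup in
theorem dG_one {G : Type*} [Group G] [Finite G] (h : dG G ≤ 1) : ∃ a : G, zpowers a = ⊤ := by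
  classical
  have hne : {n | ∃ S : Finset G, S.card = n ∧ closure (S : Set G) = ⊤}.Nonempty := by
    haveI := Fintype.ofFinite G
    exact ⟨_, Finset.univ, rfl, by simp⟩
  obtain ⟨S, hS, hcl⟩ := Nat.sInf_mem hne
  have hS2 : S.card ≤ 1 := by rw [hS]; exact h
  interval_cases hc : S.card
  · rw [Finset.card_eq_zero] at hc
    refine ⟨1, ?_⟩
    rw [eq_top_iff, ← hcl, hc]
    simp
  · obtain ⟨a, ha⟩ := Finset.card_eq_one.1 hc
    exact ⟨a, by rw [← hcl, ha, zpowers_eq_closure]; simp⟩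

open Subgroup in
theorem twoGen_of {G : Type*} [Group G] [Finite G] (h : ∀ H : Subgroup G, dG H ≤ 2) : TwoGen G := by
  intro H
  obtain ⟨a, b, hab⟩ := dG_pair (h H)
  refine ⟨a, b, ?_⟩
  have := congrArg (map H.subtype) hab
  rw [MonoidHom.map_closure, Set.image_pair, ← MonoidHom.range_eq_map, range_subtype] at this
  exact this.symm

open Subgroup in
theorem noScalar_of {p : ℕ} {P : Type*} [Group P] [Finite P] (α : P ≃* P) (k : ℤ)
    (hp : p.Prime) (hP : IsPGroup p P) (hk : ¬ (p : ℤ) ∣ k - 1)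
    (hα : ∀ x, (α.toMonoidHom)^[p] x = α.toMonoidHom x)
    (hd : ∀ H : Subgroup P, dG H ≤ 2)
    (hmax : ∀ H : Subgroup P, H ≠ ⊤ → dG H = 2 →
    H.map α.toMonoidHom ≠ H ∨
      ¬ ∃ k : ℤ, ¬ ((p : ℤ) ∣ k - 1) ∧
        ∀ x : H, α (x : P) * ((x : P) ^ k)⁻¹ ∈ (frattini H).map H.subtype) :
    NoScalar p k α.toMonoidHom := by
  intro N F H hNF hFH hHt hidx hpow hcomm hH hF
  have h2 := twoGen_of hd
  have hsc := scalar_of_chain α.toMonoidHom p hp k hα N F H hNF hFH hpow hcomm hH hF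
  have hNH := hNF.trans hFH
  have hdH : dG H = 2 := by
    apply le_antisymm (hd H)
    by_contra hlt
    obtain ⟨a, ha⟩ := dG_one (G := H) (by omega)
    have hn : (N.subgroupOf H).Normal := mem_normal_of_comm _ (by
      intro x y
      rw [mem_subgroupOf]
      exact hcomm x x.2 y y.2)
    have hle : Nat.card (H ⧸ N.subgroupOf H) ≤ p := by
      have hz : ∀ z : H ⧸ N.subgroupOf H, z ∈ zpowers (QuotientGroup.mk a : H ⧸ N.subgroupOf H) := by
        intro z
        obtain ⟨z, rfl⟩ := QuotientGroup.mk_surjective z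
        have : z ∈ zpowers a := ha ▸ mem_top z
        obtain ⟨i, rfl⟩ := mem_zpowers_iff.1 this
        exact ⟨i, rfl⟩
      rw [← orderOf_eq_card_of_forall_mem_zpowers hz]
      apply orderOf_le_of_pow_eq_one hp.pos
      rw [← QuotientGroup.mk_pow, QuotientGroup.eq_one_iff, mem_subgroupOf]
      exact hpow a a.2
    have : p ^ 2 ≤ p := by rw [← hidx]; exact hle
    have := hp.one_lt
    nlinarith
  rcases hmax H hHt hdH with h | h
  · apply h
    apply eq_of_le_of_card_ge
    · rintro _ ⟨x, hx, rfl⟩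
      have := H.mul_mem (hNH (hsc x hx)) (H.zpow_mem hx k)
      simpa using this
    · exact (card_map_of_injective α.injective).ge
  · apply h
    refine ⟨k, hk, fun x => ?_⟩
    have hNΦ : N.subgroupOf H ≤ frattini H := by
      refine le_iInf₂ ?_
      intro K hK
      obtain ⟨h1, h2'⟩ := coatom_props p hp (hP.to_subgroup H) K hK
      have hle := relIndex_le h2 p hp (K.map H.subtype ⊓ N) H
        (fun x hx => ⟨⟨_, h1 ⟨x, hx⟩, rfl⟩, hpow x hx⟩)
        (fun x hx y hy => ⟨⟨_, h2' ⟨x, hx⟩ ⟨y, hy⟩, rfl⟩, hcomm x hx y hy⟩)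
      rw [← hidx, ← relIndex_mul_relIndex (K.map H.subtype ⊓ N) N H inf_le_right hNH] at hle
      have hpos : 0 < N.relIndex H := by rw [hidx]; exact pow_pos hp.pos 2
      have h0 : (K.map H.subtype ⊓ N).relIndex N ≠ 0 := by
        exact Subgroup.index_ne_zero_of_finite
      have h1' : (K.map H.subtype ⊓ N).relIndex N = 1 := by
        have : (K.map H.subtype ⊓ N).relIndex N ≤ 1 := by
          by_contra hh
          push Not at hh
          nlinarith
        omega
      rw [relIndex_eq_one] at h1'
      intro y hy
      rw [mem_subgroupOf] at hy
      obtain ⟨z, hz, hzy⟩ := (h1' hy).1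
      have : z = y := Subtype.ext hzy
      exact this ▸ hz
    have hm := hsc x x.2
    exact ⟨⟨_, hNH hm⟩, hNΦ (mem_subgroupOf.2 hm), rfl⟩

open Subgroup in
theorem TwoGen.of_surjective {G G' : Type*} [Group G] [Group G'] (h : TwoGen G) (f : G →* G')
    (hf : Function.Surjective f) : TwoGen G' := by
  intro H
  obtain ⟨a, b, hab⟩ := h (H.comap f)
  refine ⟨f a, f b, ?_⟩
  rw [← map_comap_eq_self_of_surjective hf H, hab, MonoidHom.map_closure, Set.image_pair]

open Subgroup in
theorem NoScalar.of_surjective {p : ℕ} {k : ℤ} {G G' : Type*} [Group G] [Group G'] {β : G →* G}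
    (h : NoScalar p k β) (f : G →* G') (hf : Function.Surjective f) (β' : G' →* G')
    (hβ : ∀ x, β' (f x) = f (β x)) : NoScalar p k β' := by
  intro N F H hNF hFH hHt hidx hpow hcomm hH hF
  refine h (N.comap f) (F.comap f) (H.comap f) (comap_mono hNF) (comap_mono hFH) ?_ ?_ ?_ ?_ ?_ ?_
  · intro ht
    apply hHt
    rw [← map_comap_eq_self_of_surjective hf H, ht, ← MonoidHom.range_eq_map]
    exact MonoidHom.range_eq_top.2 hf
  · rw [relIndex_comap, map_comap_eq_self_of_surjective hf, hidx]
  · intro x hx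
    rw [mem_comap, map_pow]
    exact hpow _ hx
  · intro x hx y hy
    rw [mem_comap, map_commutatorElement]
    exact hcomm _ hx _ hy
  · intro x hx
    have := hH _ hx
    simpa [mem_comap, hβ] using this
  · intro x hx
    have := hF _ hx
    simpa [mem_comap, hβ] using this

open Subgroup in
theorem le_relIndex {G : Type*} [Group G] [Finite G] {p : ℕ} (hp : p.Prime) (hG : IsPGroup p G)
    (A B : Subgroup G) (h : ¬ B ≤ A) : p ≤ A.relIndex B := by
  haveI := Fact.mk hp
  obtain ⟨n, hn⟩ := IsPGroup.iff_card.1 (hG.to_subgroup B)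
  have hd := relIndex_dvd_card A B
  rw [hn, Nat.dvd_prime_pow hp] at hd
  obtain ⟨m, _, hm⟩ := hd
  have : m ≠ 0 := by
    rintro rfl
    rw [pow_zero, relIndex_eq_one] at hm
    exact h hm
  rw [hm]
  exact Nat.le_self_pow this p

open Subgroup in
theorem step1 {Q : Type*} [CommGroup Q] [Finite Q] {p : ℕ} (hp : p.Prime) (hQ : IsPGroup p Q)
    (k : ℤ) (β : Q →* Q) (h2 : TwoGen Q) (hns : NoScalar p k β)
    (hnc : ∀ x : Q, zpowers x ⊔ (powMonoidHom p).range ≠ ⊤)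
    (hβ : ∀ x, β x * (x ^ k)⁻¹ ∈ (powMonoidHom p : Q →* Q).range) : ∀ x : Q, x ^ p = 1 := by
  haveI := Fact.mk hp
  set R : Subgroup Q := (powMonoidHom p : Q →* Q).range with hR
  set R2 : Subgroup Q := R.map (powMonoidHom p : Q →* Q) with hR2
  have hRm : ∀ x : Q, x ^ p ∈ R := fun x => ⟨x, rfl⟩
  have hR2m : ∀ x ∈ R, x ^ p ∈ R2 := fun x hx => ⟨x, hx, rfl⟩
  have hR2R : R2 ≤ R := by
    rintro _ ⟨x, hx, rfl⟩
    exact ⟨x, rfl⟩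
  by_contra hne
  push Not at hne
  obtain ⟨g, hg⟩ := hne
  have hlt : ¬ R ≤ R2 := by
    intro hle
    have hn : ∀ n : ℕ, R ≤ (powMonoidHom (p ^ n) : Q →* Q).range := by
      intro n
      induction n with
      | zero => intro x _; exact ⟨x, by simp⟩
      | succ n ih =>
        intro x hx
        obtain ⟨y, hy, rfl⟩ := hle hx
        obtain ⟨z, rfl⟩ := ih hy
        exact ⟨z, by simp [pow_succ, pow_mul]⟩
    obtain ⟨n, hcard⟩ := IsPGroup.iff_card.1 hQ
    obtain ⟨z, hz⟩ := hn n (hRm g)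
    apply hg
    rw [← hz, ← hcard]
    exact pow_card_eq_one'
  obtain ⟨a, b, hab⟩ := h2 ⊤
  have ha : a ∉ R := by
    intro ha
    apply hnc b
    rw [eq_top_iff, hab, closure_le]
    rintro y (rfl | rfl)
    · exact mem_sup_right ha
    · exact mem_sup_left (mem_zpowers _)
  obtain ⟨x, hxR, hx⟩ : ∃ x, x ∉ R ∧ ¬ R ≤ R2 ⊔ zpowers (x ^ p) := by
    by_cases h : R ≤ R2 ⊔ zpowers (a ^ p)
    · obtain ⟨r, hr, z, hz, hrz⟩ := mem_sup.1 (h (hRm b))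
      obtain ⟨j, rfl⟩ := mem_zpowers_iff.1 hz
      refine ⟨b * (a ^ j)⁻¹, ?_, ?_⟩
      · intro hR'
        apply hnc a
        rw [eq_top_iff, hab, closure_le]
        rintro y (rfl | rfl)
        · exact mem_sup_left (mem_zpowers _)
        · rw [SetLike.mem_coe, mem_sup]
          exact ⟨a ^ j, zpow_mem (mem_zpowers a) j, _, hR', by simp⟩
      · intro hle
        apply hlt
        refine hle.trans (sup_le le_rfl ?_)
        rw [zpowers_le, mul_pow, ← hrz, inv_pow, ← zpow_natCast (a ^ j), ← zpow_natCast a,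
          ← zpow_mul, ← zpow_mul, mul_comm j]
        simpa using hr
    · exact ⟨a, ha, h⟩
  have hNF : R2 ⊔ zpowers (x ^ p) ≤ R := sup_le hR2R ((zpowers_le).2 (hRm x))
  have hpow : ∀ y ∈ zpowers x ⊔ R, y ^ p ∈ R2 ⊔ zpowers (x ^ p) := by
    intro y hy
    obtain ⟨s, hs, r, hr, rfl⟩ := mem_sup.1 hy
    obtain ⟨j, rfl⟩ := mem_zpowers_iff.1 hs
    rw [mul_pow]
    refine mul_mem (mem_sup_right ⟨j, ?_⟩) (mem_sup_left (hR2m r hr))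
    simp only [← zpow_natCast, ← zpow_mul]
    rw [mul_comm]
  have hcomm : ∀ y ∈ zpowers x ⊔ R, ∀ z ∈ zpowers x ⊔ R, ⁅y, z⁆ ∈ R2 ⊔ zpowers (x ^ p) := by
    intro y _ z _
    rw [commutatorElement_eq_one_iff_mul_comm.2 (mul_comm y z)]
    exact one_mem _
  refine hns (R2 ⊔ zpowers (x ^ p)) R (zpowers x ⊔ R) hNF le_sup_right (hnc x) ?_ hpow hcomm
    (fun y _ => hβ y) ?_
  · apply le_antisymm (relIndex_le h2 p hp _ _ hpow hcomm)
    rw [← relIndex_mul_relIndex _ R _ hNF le_sup_right, sq]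
    apply Nat.mul_le_mul
    · exact le_relIndex hp hQ _ _ hx
    · apply le_relIndex hp hQ
      intro h
      exact hxR (h (mem_sup_left (mem_zpowers x)))
  · rintro _ ⟨z, rfl⟩
    refine mem_sup_left ⟨_, hβ z, ?_⟩
    simp only [powMonoidHom_apply, map_pow, mul_pow, inv_pow]
    congr 2
    simp only [← zpow_natCast, ← zpow_mul]
    rw [mul_comm]

theorem comm_zpow_left {G : Type*} [Group G] (x y : G) (h : Commute ⁅x, y⁆ x) (n : ℤ) :
    ⁅x ^ n, y⁆ = ⁅x, y⁆ ^ n := by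
  have h1 : y * x * y⁻¹ = ⁅x, y⁆⁻¹ * x := by simp [commutatorElement_def, mul_assoc]
  have h2 : y * x ^ n * y⁻¹ = ⁅x, y⁆⁻¹ ^ n * x ^ n := by
    rw [← conj_zpow, h1, (h.inv_left).mul_zpow]
  have h3 : ⁅x ^ n, y⁆ = x ^ n * (y * x ^ n * y⁻¹)⁻¹ := by simp [commutatorElement_def, mul_assoc]
  rw [h3, h2, inv_zpow, mul_inv_rev, inv_inv, mul_inv_cancel_left]

theorem comm_zpow_right {G : Type*} [Group G] (x y : G) (h : Commute ⁅x, y⁆ y) (n : ℤ) :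
    ⁅x, y ^ n⁆ = ⁅x, y⁆ ^ n := by
  have h1 : x * y * x⁻¹ = ⁅x, y⁆ * y := by simp [commutatorElement_def]
  have h2 : x * y ^ n * x⁻¹ = ⁅x, y⁆ ^ n * y ^ n := by
    rw [← conj_zpow, h1, h.mul_zpow]
  rw [commutatorElement_def, h2]
  simp

theorem comm_mul_left {G : Type*} [Group G] (x y z : G) (h : Commute ⁅y, z⁆ x) :
    ⁅x * y, z⁆ = ⁅y, z⁆ * ⁅x, z⁆ := by
  have : ⁅x * y, z⁆ = x * ⁅y, z⁆ * x⁻¹ * ⁅x, z⁆ := by simp [commutatorElement_def, mul_assoc]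
  rw [this, ← h.eq, mul_inv_cancel_right]

theorem comm_mul_right {G : Type*} [Group G] (x y z : G) (h : Commute ⁅z, y⁆ x) :
    ⁅z, x * y⁆ = ⁅z, x⁆ * ⁅z, y⁆ := by
  have : ⁅z, x * y⁆ = ⁅z, x⁆ * (x * ⁅z, y⁆ * x⁻¹) := by simp [commutatorElement_def, mul_assoc]
  rw [this, ← h.eq, mul_inv_cancel_right]

theorem zpow_eq_one_of {G : Type*} [Group G] {p : ℕ} (hp : p.Prime) (x : G) (hx : x ^ p = 1)
    (n : ℤ) (hn : ¬ (p : ℤ) ∣ n) (h : x ^ n = 1) : x = 1 := by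
  have hcop : IsCoprime (p : ℤ) n := (Nat.prime_iff_prime_int.1 hp).coprime_iff_not_dvd.2 hn
  obtain ⟨u, v, huv⟩ := hcop
  rw [← zpow_one x, ← huv, zpow_add, mul_comm u, mul_comm v, zpow_mul, zpow_mul, h, zpow_natCast, hx]
  simp

open Subgroup in
theorem step2 {G : Type*} [Group G] {p : ℕ} (hp : p.Prime)
    (k : ℤ) (hk1 : ¬ (p : ℤ) ∣ k - 1) (hk0 : ¬ (p : ℤ) ∣ k) (β : G →* G)
    (hcen : commutator G ≤ center G) (hpow : ∀ x : G, x ^ p ∈ commutator G)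
    (hβ : ∀ x, β x * (x ^ k)⁻¹ ∈ commutator G) :
    (∀ x : G, x ^ p = 1) ∧ ∀ f ∈ commutator G, β f = f ^ (k * k) := by
  have hcm : ∀ x y z : G, Commute ⁅x, y⁆ z := by
    intro x y z
    have : ⁅x, y⁆ ∈ center G := hcen (commutator_mem_commutator (mem_top x) (mem_top y))
    exact (mem_center_iff.1 this z).symm
  have hcc : ∀ f ∈ commutator G, ∀ z, Commute f z := by
    intro f hf z
    exact (mem_center_iff.1 (hcen hf) z).symm
  have hexp : ∀ f ∈ commutator G, f ^ p = 1 ∧ β f = f ^ (k * k) := by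
    intro f hf
    have hf' := hf
    rw [commutator_eq_closure] at hf
    induction hf using closure_induction with
    | mem f hf =>
      obtain ⟨x, y, rfl⟩ := hf
      constructor
      · rw [← zpow_natCast, ← comm_zpow_left x y (hcm _ _ _),
          commutatorElement_eq_one_iff_mul_comm, zpow_natCast]
        exact hcc _ (hpow x) y
      · have hx : β x = (β x * (x ^ k)⁻¹) * x ^ k := by simp
        have hy : β y = (β y * (y ^ k)⁻¹) * y ^ k := by simp
        rw [map_commutatorElement, hx, hy]
        generalize hu : β x * (x ^ k)⁻¹ = u
        generalize hv : β y * (y ^ k)⁻¹ = v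
        have hu' : ∀ z, Commute u z := hcc u (hu ▸ hβ x)
        have hv' : ∀ z, Commute v z := hcc v (hv ▸ hβ y)
        have : ⁅u * x ^ k, v * y ^ k⁆ = ⁅x ^ k, y ^ k⁆ := by
          have e1 : ∀ s t : G, ⁅u * s, t⁆ = ⁅s, t⁆ := by
            intro s t
            have : ⁅u * s, t⁆ = u * (s * t * s⁻¹) * u⁻¹ * t⁻¹ := by
              simp [commutatorElement_def, mul_assoc]
            rw [this, (hu' _).eq]
            simp [commutatorElement_def, mul_assoc]
          have e2 : ∀ s t : G, ⁅s, v * t⁆ = ⁅s, t⁆ := by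
            intro s t
            have : ⁅s, v * t⁆ = s * v * (t * s⁻¹ * t⁻¹) * v⁻¹ := by
              simp [commutatorElement_def, mul_assoc]
            rw [this, ← (hv' s).eq, mul_assoc v, (hv' _).eq]
            simp [commutatorElement_def, mul_assoc]
          rw [e1, e2]
        rw [this, comm_zpow_left _ _ (hcm _ _ _), comm_zpow_right _ _ (hcm _ _ _), ← zpow_mul]
    | one => simp
    | mul x y hx hy h1 h2 =>
      rw [← commutator_eq_closure] at hx hy
      obtain ⟨a1, a2⟩ := h1 hx
      obtain ⟨b1, b2⟩ := h2 hy
      have hxy : Commute x y := hcc x hx y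
      exact ⟨by rw [hxy.mul_pow, a1, b1, one_mul], by rw [map_mul, a2, b2, hxy.mul_zpow]⟩
    | inv x hx h1 =>
      rw [← commutator_eq_closure] at hx
      obtain ⟨a1, a2⟩ := h1 hx
      exact ⟨by rw [inv_pow, a1, inv_one], by rw [map_inv, a2, inv_zpow]⟩
  refine ⟨fun x => ?_, fun f hf => (hexp f hf).2⟩
  have h1 := (hexp _ (hpow x)).2
  have h0 := (hexp _ (hpow x)).1
  have hx : β x = (β x * (x ^ k)⁻¹) * x ^ k := by simp
  have h3 : β (x ^ p) = (x ^ p) ^ k := by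
    rw [map_pow, hx, (hcc _ (hβ x) _).mul_pow, (hexp _ (hβ x)).1, one_mul]
    simp only [← zpow_natCast, ← zpow_mul]
    rw [mul_comm]
  apply zpow_eq_one_of hp _ h0 (k * (k - 1))
  · intro hd
    rcases (Nat.prime_iff_prime_int.1 hp).dvd_or_dvd hd with h | h
    · exact hk0 h
    · exact hk1 h
  · rw [mul_sub, mul_one, zpow_sub, ← h1, h3, mul_inv_cancel]

open Subgroup in
theorem map_commutator_top {G G' : Type*} [Group G] [Group G'] (f : G →* G')
    (hf : Function.Surjective f) : (commutator G).map f = commutator G' := by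
  rw [commutator_def, commutator_def, map_commutator, ← MonoidHom.range_eq_map,
    MonoidHom.range_eq_top.2 hf]

open Subgroup in
theorem step2' {P : Type*} [Group P] {p : ℕ} (hp : p.Prime)
    (k : ℤ) (hk1 : ¬ (p : ℤ) ∣ k - 1) (hk0 : ¬ (p : ℤ) ∣ k) (β : P →* P)
    (hpow : ∀ x : P, x ^ p ∈ commutator P)
    (hβ : ∀ x, β x * (x ^ k)⁻¹ ∈ commutator P) :
    (∀ x : P, x ^ p ∈ ⁅commutator P, (⊤ : Subgroup P)⁆) ∧
    ∀ f ∈ commutator P, β f * (f ^ (k * k))⁻¹ ∈ ⁅commutator P, (⊤ : Subgroup P)⁆ := by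
  set T : Subgroup P := ⁅commutator P, (⊤ : Subgroup P)⁆ with hT
  haveI : T.Normal := by rw [hT]; infer_instance
  let π : P →* P ⧸ T := QuotientGroup.mk' T
  have hπ : Function.Surjective π := QuotientGroup.mk'_surjective T
  have hker : ∀ x, π x = 1 ↔ x ∈ T := fun x => QuotientGroup.eq_one_iff x
  have hTβ : T ≤ T.comap β := by
    rw [← map_le_iff_le_comap, hT, map_commutator]
    apply commutator_mono _ le_top
    rw [commutator_def, map_commutator]
    exact commutator_mono le_top le_top
  let βT : P ⧸ T →* P ⧸ T := QuotientGroup.map T T β hTβ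
  have hβT : ∀ x, βT (π x) = π (β x) := fun x => rfl
  have hcom := map_commutator_top π hπ
  have := step2 (G := P ⧸ T) hp k hk1 hk0 βT (by
      rw [← hcom]
      rintro _ ⟨f, hf, rfl⟩
      rw [mem_center_iff]
      intro g
      obtain ⟨g, rfl⟩ := hπ g
      symm
      rw [← commutatorElement_eq_one_iff_mul_comm, ← map_commutatorElement, hker]
      exact commutator_mem_commutator hf (mem_top g))
    (by
      intro x
      obtain ⟨x, rfl⟩ := hπ x
      rw [← map_pow, ← hcom]
      exact ⟨_, hpow x, rfl⟩)
    (by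
      intro x
      obtain ⟨x, rfl⟩ := hπ x
      rw [hβT, ← map_zpow, ← map_inv, ← map_mul, ← hcom]
      exact ⟨_, hβ x, rfl⟩)
  obtain ⟨h1, h2⟩ := this
  constructor
  · intro x
    rw [← hker, map_pow]
    exact h1 _
  · intro f hf
    rw [← hker, map_mul, ← hβT, h2 (π f) (hcom ▸ ⟨f, hf, rfl⟩)]
    simp

open Subgroup in
theorem commutator_le_pair {G : Type*} [Group G] (a b : G) (hab : closure {a, b} = ⊤) :
    commutator G ≤ zpowers ⁅a, b⁆ ⊔ ⁅commutator G, (⊤ : Subgroup G)⁆ := by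
  set T : Subgroup G := ⁅commutator G, (⊤ : Subgroup G)⁆ with hT
  set C := zpowers ⁅a, b⁆ ⊔ T with hC
  have hTD : T ≤ commutator G := commutator_le_left _ _
  have hCD : C ≤ commutator G := sup_le
    ((zpowers_le).2 (commutator_mem_commutator (mem_top a) (mem_top b))) hTD
  haveI : C.Normal := by
    refine ⟨fun n hn g => ?_⟩
    have h1 : ⁅n, g⁆⁻¹ ∈ T := inv_mem (commutator_mem_commutator (hCD hn) (mem_top g))
    have h2 := C.mul_mem (mem_sup_right h1 : ⁅n, g⁆⁻¹ ∈ C) hn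
    simpa [commutatorElement_def, mul_assoc] using h2
  let π : G →* G ⧸ C := QuotientGroup.mk' C
  have hπ : Function.Surjective π := QuotientGroup.mk'_surjective C
  have hker : ∀ x, π x = 1 ↔ x ∈ C := fun x => QuotientGroup.eq_one_iff x
  have hcl : closure {π a, π b} = ⊤ := by
    rw [← Set.image_pair, ← MonoidHom.map_closure, hab, ← MonoidHom.range_eq_map]
    exact MonoidHom.range_eq_top.2 hπ
  have hab' : π a * π b = π b * π a := by
    rw [← commutatorElement_eq_one_iff_mul_comm, ← map_commutatorElement, hker]
    exact mem_sup_left (mem_zpowers _)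
  have hcen : ∀ g ∈ ({π a, π b} : Set (G ⧸ C)), g ∈ center (G ⧸ C) := by
    intro g hg
    have : (⊤ : Subgroup (G ⧸ C)) ≤ centralizer {g} := by
      rw [← hcl, closure_le]
      rintro y hy
      rw [SetLike.mem_coe, mem_centralizer_singleton_iff]
      rcases hg with rfl | rfl <;> rcases hy with rfl | rfl <;> simp [hab']
    rw [mem_center_iff]
    intro y
    exact mem_centralizer_singleton_iff.1 (this (mem_top y))
  have htop : (⊤ : Subgroup (G ⧸ C)) ≤ center _ := by
    rw [← hcl, closure_le]
    exact hcen
  rw [commutator_def, commutator_le]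
  intro x _ y _
  rw [← hker, map_commutatorElement, commutatorElement_eq_one_iff_mul_comm]
  exact mem_center_iff.1 (htop (mem_top (π y))) (π x)

theorem pow_formula {G : Type*} [Group G] (a b c w : G) (h1 : a * b = b * a * c)
    (h2 : c * b = b * c * w) (hac : Commute a c) (hwa : Commute w a) (hwb : Commute w b)
    (hwc : Commute w c) (n : ℕ) :
    (b * a) ^ n = b ^ n * a ^ n * c ^ (n.choose 2) * w ^ (n.choose 3) := by
  have ha : ∀ n : ℕ, a ^ n * b = b * (a ^ n * c ^ n) := by
    intro n
    have : b⁻¹ * a * b = a * c := by rw [mul_assoc, h1]; group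
    have h3 : b⁻¹ * a ^ n * b = a ^ n * c ^ n := by
      rw [← hac.mul_pow, ← this]
      simpa using (conj_pow (i := n) (a := b⁻¹) (b := a)).symm
    rw [← h3]; group
  have hc : ∀ n : ℕ, c ^ n * b = b * (c ^ n * w ^ n) := by
    intro n
    have : b⁻¹ * c * b = c * w := by rw [mul_assoc, h2]; group
    have h3 : b⁻¹ * c ^ n * b = c ^ n * w ^ n := by
      rw [← hwc.symm.mul_pow, ← this]
      simpa using (conj_pow (i := n) (a := b⁻¹) (b := c)).symm
    rw [← h3]; group
  induction n with
  | zero => simp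
  | succ n ih =>
    have e2 : (n + 1).choose 2 = n + n.choose 2 := by
      rw [Nat.choose_succ_succ' n 1, Nat.choose_one_right]
    have e3 : (n + 1).choose 3 = n.choose 2 + n.choose 3 := Nat.choose_succ_succ' n 2
    rw [pow_succ, ih, e2, e3]
    set m := n.choose 2
    set l := n.choose 3
    calc b ^ n * a ^ n * c ^ m * w ^ l * (b * a)
        = b ^ n * a ^ n * c ^ m * (w ^ l * (b * a)) := by group
      _ = b ^ n * a ^ n * c ^ m * ((b * a) * w ^ l) := by
          rw [((hwb.mul_right hwa).pow_left l).eq]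
      _ = b ^ n * a ^ n * (c ^ m * b) * a * w ^ l := by group
      _ = b ^ n * (a ^ n * b) * c ^ m * (w ^ m * a) * w ^ l := by rw [hc]; group
      _ = b ^ n * b * a ^ n * (c ^ n * c ^ m * a) * w ^ m * w ^ l := by
          rw [ha, (hwa.pow_left m).eq]; group
      _ = b ^ n * b * a ^ n * (a * (c ^ n * c ^ m)) * w ^ m * w ^ l := by
          rw [← pow_add, (hac.pow_right _).eq]
      _ = b ^ (n + 1) * a ^ (n + 1) * c ^ (n + m) * w ^ (m + l) := by
          simp only [pow_succ, pow_add, mul_assoc]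

open Subgroup in
theorem step3 {G : Type*} [Group G] [Finite G] {p : ℕ} (hp : p.Prime) (hp3 : 3 < p)
    (hG : IsPGroup p G) (k : ℤ) (hk1 : ¬ (p : ℤ) ∣ k - 1) (hk0 : ¬ (p : ℤ) ∣ k) (β : G →* G)
    (h2 : TwoGen G) (hns : NoScalar p k β)
    (hpow : ∀ x : G, x ^ p ∈ commutator G)
    (hβ : ∀ x, β x * (x ^ k)⁻¹ ∈ commutator G)
    (hnc : ∀ x : G, zpowers x ⊔ commutator G ≠ ⊤)
    (hidx : (commutator G).index = p ^ 2)
    (hTcen : ⁅commutator G, (⊤ : Subgroup G)⁆ ≤ center G)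
    (hTne : ⁅commutator G, (⊤ : Subgroup G)⁆ ≠ ⊥) : False := by
  haveI := Fact.mk hp
  obtain ⟨hpowT, hβD⟩ := step2' hp k hk1 hk0 β hpow hβ
  obtain ⟨a0, b0, hab⟩ := h2 ⊤
  have hDc := commutator_le_pair a0 b0 hab.symm
  generalize hc : ⁅a0, b0⁆ = c at hDc
  have hcD : c ∈ commutator G := hc ▸ commutator_mem_commutator (mem_top _) (mem_top _)
  set D := commutator G with hD
  set T : Subgroup G := ⁅D, (⊤ : Subgroup G)⁆ with hT
  haveI : D.Normal := by rw [hD]; infer_instance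
  haveI : T.Normal := by rw [hT]; infer_instance
  have hTD : T ≤ D := commutator_le_left _ _
  have hcen : ∀ w ∈ T, ∀ x, Commute w x := fun w hw x => (mem_center_iff.1 (hTcen hw) x).symm
  have hfx : ∀ f ∈ D, ∀ x, ⁅f, x⁆ ∈ T := fun f hf x => commutator_mem_commutator hf (mem_top x)
  have hmD : ∀ x y : G, ⁅x, y⁆ ∈ D := fun x y => commutator_mem_commutator (mem_top x) (mem_top y)
  have hDz : ∀ f ∈ D, ∃ (i : ℤ), ∃ t ∈ T, f = c ^ i * t := by
    intro f hf
    obtain ⟨z, hz, t, ht, rfl⟩ := mem_sup_of_normal_right.1 (hDc hf)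
    obtain ⟨i, rfl⟩ := mem_zpowers_iff.1 hz
    exact ⟨i, t, ht, rfl⟩
  have hDD : ∀ f ∈ D, ∀ g ∈ D, Commute f g := by
    intro f hf g hg
    obtain ⟨i, t, ht, rfl⟩ := hDz f hf
    obtain ⟨j, s, hs, rfl⟩ := hDz g hg
    refine Commute.mul_left ?_ (hcen t ht _)
    refine Commute.mul_right ?_ (hcen s hs _).symm
    exact (Commute.refl c).zpow_zpow i j
  have hDne : D ≠ ⊥ := by
    intro h
    apply hTne
    rw [eq_bot_iff, ← h]
    exact hTD
  -- `c ∉ T`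
  have hDT : ¬ D ≤ T := by
    intro h
    apply hTne
    rw [hT, commutator_eq_bot_iff_le_centralizer]
    refine (h.trans hTcen).trans ?_
    exact center_le_centralizer _
  -- exponent of `T`
  have hTfacts : ∀ w ∈ T, w ^ p = 1 ∧ β w = w ^ (k * k * k) := by
    intro w hw
    have hw' : w ∈ ⁅D, (⊤ : Subgroup G)⁆ := hw
    rw [Subgroup.commutator_def] at hw'
    induction hw' using closure_induction with
    | mem w h =>
      obtain ⟨f, hf, x, _, rfl⟩ := h
      constructor
      · rw [← zpow_natCast, ← comm_zpow_left f x (hcen _ (hfx f hf x) _),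
          commutatorElement_eq_one_iff_mul_comm, zpow_natCast]
        exact hcen _ (hpowT f) x
      · have e1 : β f = (β f * (f ^ (k * k))⁻¹) * f ^ (k * k) := by simp
        have e2 : β x = (β x * (x ^ k)⁻¹) * x ^ k := by simp
        rw [map_commutatorElement, e1, e2]
        generalize hu : β f * (f ^ (k * k))⁻¹ = u
        generalize hv : β x * (x ^ k)⁻¹ = v
        have huT : u ∈ T := hu ▸ hβD f hf
        have hvD : v ∈ D := hv ▸ hβ x
        have hfk : f ^ (k * k) ∈ D := D.zpow_mem hf _
        rw [comm_mul_left _ _ _ (hcen _ (hfx _ hfk _) _),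
          commutatorElement_eq_one_iff_mul_comm.2 (hcen u huT _).eq, mul_one,
          comm_mul_right _ _ _ (hcen _ (hfx _ hfk _) _),
          commutatorElement_eq_one_iff_mul_comm.2 (hDD _ hfk v hvD).eq, one_mul,
          comm_zpow_left _ _ (hcen _ (hfx f hf _) _), comm_zpow_right _ _ (hcen _ (hfx f hf _) _),
          ← zpow_mul]
        congr 1
        ring
    | one => simp
    | mul x y hx hy h1 h2 =>
      rw [← Subgroup.commutator_def] at hx hy
      obtain ⟨a1, a2⟩ := h1 hx
      obtain ⟨b1, b2⟩ := h2 hy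
      have hxy : Commute x y := hcen x hx y
      exact ⟨by rw [hxy.mul_pow, a1, b1, one_mul], by rw [map_mul, a2, b2, hxy.mul_zpow]⟩
    | inv x hx h1 =>
      rw [← Subgroup.commutator_def] at hx
      obtain ⟨a1, a2⟩ := h1 hx
      exact ⟨by rw [inv_pow, a1, inv_one], by rw [map_inv, a2, inv_zpow]⟩
  have hch2 : ∀ w ∈ T, w ^ (p.choose 2) = 1 := by
    intro w hw
    obtain ⟨m, hm⟩ := hp.dvd_choose_self (k := 2) (by norm_num) (by omega)
    rw [hm, pow_mul, (hTfacts w hw).1, one_pow]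
  -- products with elements of `D`
  have hmulD0 : ∀ x, ∀ f ∈ D, (x * f) ^ p = x ^ p * f ^ p := by
    intro x f hf
    have hw : ⁅f⁻¹, x⁻¹⁆ ∈ T := hfx _ (D.inv_mem hf) _
    have := pow_formula f x ⁅f⁻¹, x⁻¹⁆ 1 (by simp [commutatorElement_def, mul_assoc])
      (by rw [mul_one]; exact (hcen _ hw x).eq) (hcen _ hw f).symm (Commute.one_left _)
      (Commute.one_left _) (Commute.one_left _) p
    rw [this, hch2 _ hw]
    simp
  have hDp : ∀ f ∈ D, f ^ p = 1 := by
    intro f hf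
    have hf' := hf
    rw [hD, commutator_eq_closure] at hf'
    induction hf' using closure_induction with
    | mem f h =>
      obtain ⟨x, y, rfl⟩ := h
      have e1 : x⁻¹ * ⁅x, y⁆ = y * x⁻¹ * y⁻¹ := by simp [commutatorElement_def, mul_assoc]
      have e2 := hmulD0 x⁻¹ ⁅x, y⁆ (hmD x y)
      rw [e1, conj_pow, ← (hcen _ (hpowT x⁻¹) y).eq, mul_inv_cancel_right] at e2
      exact left_eq_mul.1 e2
    | one => simp
    | mul x y hx hy h1 h2 =>
      rw [← commutator_eq_closure] at hx hy
      rw [(hDD x hx y hy).mul_pow, h1 hx, h2 hy, one_mul]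
    | inv x hx h1 =>
      rw [← commutator_eq_closure] at hx
      rw [inv_pow, h1 hx, inv_one]
  have hmulD : ∀ x, ∀ f ∈ D, (f * x) ^ p = x ^ p := by
    intro x f hf
    have e : f * x = x * (x⁻¹ * f * x) := by group
    have hf' : x⁻¹ * f * x ∈ D := by
      simpa using (inferInstance : D.Normal).conj_mem f hf x⁻¹
    rw [e, hmulD0 x _ hf', hDp _ hf', mul_one]
  have hβdec : ∀ x, β x = (β x * (x ^ k)⁻¹) * x ^ k := by intro x; simp
  -- the action on p-th powers
  have hpk : ∀ x : G, (x ^ p) ^ (k * ((k - 1) * (k + 1))) = 1 := by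
    intro x
    have e1 := (hTfacts _ (hpowT x)).2
    have e2 : β (x ^ p) = (x ^ p) ^ k := by
      rw [map_pow, hβdec, hmulD _ _ (hβ x)]
      simp only [← zpow_natCast, ← zpow_mul]
      rw [mul_comm]
    have : k * ((k - 1) * (k + 1)) = k * k * k - k := by ring
    rw [this, zpow_sub, ← e1, e2, mul_inv_cancel]
  -- element centralizing `D`
  have hE : Nat.card T ≤ p → ∃ a, a ∉ D ∧ ⁅c, a⁆ = 1 := by
    intro hcard
    let φ : G →* G := MonoidHom.mk' (fun x => ⁅c, x⁆) (by
      intro x y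
      exact comm_mul_right x y c (hcen _ (hfx c hcD y) x))
    have hφ : ∀ x, φ x = ⁅c, x⁆ := fun x => rfl
    have hr : φ.range ≤ T := by
      rintro _ ⟨x, rfl⟩
      exact hfx c hcD x
    by_contra hno
    push Not at hno
    have hle : φ.ker ≤ D := by
      intro x hx
      by_contra hxD
      exact hno x hxD hx
    have h1 : D.index ∣ φ.ker.index := index_dvd_of_le hle
    rw [index_ker, hidx] at h1
    have h3 := Nat.le_of_dvd Nat.card_pos h1
    have h4 := card_le_of_le hr
    have := hp.one_lt
    nlinarith
  have hDtop : D ≠ ⊤ := by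
    intro h
    rw [h, index_top] at hidx
    have := Nat.one_lt_pow (two_ne_zero) hp.one_lt
    omega
  by_cases hk2 : (p : ℤ) ∣ k + 1
  · -- case `k = -1`
    have hTk : ∀ w ∈ T, β w = w ^ k := by
      intro w hw
      obtain ⟨m, hm⟩ := hk2
      have : k * k * k = p * (k * (k - 1) * m) + k := by
        have : k * k * k = k * (k - 1) * (k + 1) + k := by ring
        rw [this, hm]; ring
      rw [(hTfacts w hw).2, this, zpow_add, zpow_mul, zpow_natCast, (hTfacts w hw).1, one_zpow,
        one_mul]
    by_cases hcard : Nat.card T ≤ p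
    · obtain ⟨a, haD, hca⟩ := hE hcard
      have haC : ∀ f ∈ D, Commute a f := by
        intro f hf
        obtain ⟨i, t, ht, rfl⟩ := hDz f hf
        have h1 : Commute c a := commutatorElement_eq_one_iff_commute.1 hca
        exact (h1.symm.zpow_right i).mul_right (hcen t ht a).symm
      obtain ⟨x, hxD, hxp⟩ : ∃ x, x ∉ D ∧ x ^ p = 1 := by
        by_cases hap : a ^ p = 1
        · exact ⟨a, haD, hap⟩
        have hTz : zpowers (a ^ p) = T := by
          apply eq_of_le_of_card_ge
          · rw [zpowers_le]; exact hpowT a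
          · rw [Nat.card_zpowers, orderOf_eq_prime (hTfacts _ (hpowT a)).1 hap]
            exact hcard
        obtain ⟨b, hb⟩ : ∃ b, b ∉ zpowers a ⊔ D := by
          by_contra h
          push Not at h
          exact hnc a (eq_top_iff.2 fun y _ => h y)
        obtain ⟨j, hj⟩ : ∃ j : ℤ, (a ^ p) ^ j = b ^ p := by
          have := hpowT b
          rw [← hTz] at this
          exact mem_zpowers_iff.1 this
        refine ⟨b * a ^ (-j), ?_, ?_⟩
        · intro h
          apply hb
          have e : b = (b * a ^ (-j)) * a ^ j := by simp
          rw [e]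
          exact mul_mem (mem_sup_right h) (mem_sup_left (zpow_mem (mem_zpowers a) j))
        · generalize hA : a ^ (-j) = A
          have hAC : ∀ f ∈ D, Commute A f := fun f hf => hA ▸ (haC f hf).zpow_left (-j)
          have hAp : A ^ p = (b ^ p)⁻¹ := by
            rw [← hA, ← hj]
            simp only [← zpow_natCast, ← zpow_mul, ← zpow_neg]
            congr 1; ring
          have hc1 : ⁅A⁻¹, b⁻¹⁆ ∈ D := hmD _ _
          generalize hC1 : ⁅A⁻¹, b⁻¹⁆ = C1 at hc1
          have hw : ⁅C1⁻¹, b⁻¹⁆ ∈ T := hfx _ (D.inv_mem hc1) _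
          have := pow_formula A b C1 ⁅C1⁻¹, b⁻¹⁆
            (by rw [← hC1]; simp [commutatorElement_def, mul_assoc])
            (by simp [commutatorElement_def, mul_assoc])
            (hAC _ hc1) (hcen _ hw _) (hcen _ hw _) (hcen _ hw _) p
          obtain ⟨m2, hm2⟩ := hp.dvd_choose_self (k := 2) (by norm_num) (by omega)
          obtain ⟨m3, hm3⟩ := hp.dvd_choose_self (k := 3) (by norm_num) (by omega)
          rw [this, hm2, hm3, pow_mul, pow_mul, hDp _ hc1, (hTfacts _ hw).1, hAp]
          simp
      -- the eigenvector
      have hy0 := hβdec x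
      generalize hu : β x * (x ^ k)⁻¹ = u at hy0
      have huD : u ∈ D := hu ▸ hβ x
      set y := u * x ^ (k - 1) with hy
      have hyp : y ^ p = 1 := by
        rw [hy, hmulD _ _ huD, ← zpow_natCast, ← zpow_mul, mul_comm, zpow_mul, zpow_natCast, hxp,
          one_zpow]
      have hyD : y ∉ D := by
        intro h
        have h1 : x ^ (k - 1) ∈ D := (D.mul_mem_cancel_left huD).1 h
        have hcop : IsCoprime (p : ℤ) (k - 1) :=
          (Nat.prime_iff_prime_int.1 hp).coprime_iff_not_dvd.2 hk1
        obtain ⟨s, t, hst⟩ := hcop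
        apply hxD
        have : x = (x ^ (k - 1)) ^ t := by
          conv_lhs => rw [← zpow_one x, ← hst, zpow_add, mul_comm s, mul_comm t, zpow_mul,
            zpow_mul, zpow_natCast, hxp, one_zpow, one_mul]
        rw [this]
        exact D.zpow_mem h1 t
      have hβu : β u * u⁻¹ ∈ T := by
        have := hβD u huD
        obtain ⟨m, hm⟩ := hk2
        have e : k * k = p * ((k - 1) * m) + 1 := by
          have : k * k = (k - 1) * (k + 1) + 1 := by ring
          rw [this, hm]; ring
        rw [e, zpow_add, zpow_mul, zpow_natCast, hDp u huD, one_zpow, one_mul, zpow_one] at this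
        exact this
      have hβy : β y * (y ^ k)⁻¹ ∈ T := by
        let π : G →* G ⧸ T := QuotientGroup.mk' T
        have hker : ∀ x, π x = 1 ↔ x ∈ T := fun x => QuotientGroup.eq_one_iff x
        have hux : Commute (π u) (π x) := by
          rw [← commutatorElement_eq_one_iff_commute, ← map_commutatorElement, hker]
          exact hfx u huD x
        have h1 : π (β u) = π u := by
          rw [← hker, map_mul, map_inv, mul_inv_eq_one] at hβu
          exact hβu
        rw [← hker, map_mul, map_inv, mul_inv_eq_one, hy, map_mul, map_zpow, hy0, map_mul, h1]
        simp only [map_zpow, map_mul]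
        rw [(hux.zpow_right k).mul_zpow, (hux.zpow_right (k - 1)).mul_zpow, ← mul_assoc,
          ← zpow_one_add, ← zpow_mul, ← zpow_mul]
        congr 2 <;> ring
      have hHdec : ∀ h ∈ zpowers y ⊔ T, ∃ i : ℤ, ∃ t ∈ T, h = y ^ i * t := by
        intro f hf
        obtain ⟨z, hz, t, ht, rfl⟩ := mem_sup_of_normal_right.1 hf
        obtain ⟨i, rfl⟩ := mem_zpowers_iff.1 hz
        exact ⟨i, t, ht, rfl⟩
      have hHpow : ∀ h ∈ zpowers y ⊔ T, h ^ p ∈ (⊥ : Subgroup G) := by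
        intro h hh
        obtain ⟨i, t, ht, rfl⟩ := hHdec h hh
        rw [mem_bot, (hcen t ht _).symm.mul_pow, (hTfacts t ht).1, ← zpow_natCast, ← zpow_mul,
          mul_comm, zpow_mul, zpow_natCast, hyp, one_zpow, one_mul]
      have hHcomm : ∀ h ∈ zpowers y ⊔ T, ∀ g ∈ zpowers y ⊔ T, ⁅h, g⁆ ∈ (⊥ : Subgroup G) := by
        intro h hh g hg
        obtain ⟨i, t, ht, rfl⟩ := hHdec h hh
        obtain ⟨j, s, hs, rfl⟩ := hHdec g hg
        rw [mem_bot, commutatorElement_eq_one_iff_commute]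
        exact (((Commute.refl y).zpow_zpow i j).mul_right (hcen s hs _).symm).mul_left
          (hcen t ht _)
      refine hns ⊥ T (zpowers y ⊔ T) bot_le le_sup_right ?_ ?_ hHpow hHcomm ?_ ?_
      · intro htop
        apply hDne
        rw [eq_bot_iff, hD, _root_.commutator_def, commutator_le]
        intro g _ h _
        exact hHcomm g (htop ▸ mem_top g) h (htop ▸ mem_top h)
      · apply le_antisymm (relIndex_le h2 p hp _ _ hHpow hHcomm)
        rw [← relIndex_mul_relIndex _ T _ bot_le le_sup_right, sq]
        apply Nat.mul_le_mul
        · exact le_relIndex hp hG _ _ (fun h => hTne (eq_bot_iff.2 h))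
        · apply le_relIndex hp hG
          intro h
          exact hyD (hTD (h (mem_sup_left (mem_zpowers y))))
      · intro h hh
        obtain ⟨i, t, ht, rfl⟩ := hHdec h hh
        have e := hβdec y
        generalize hs : β y * (y ^ k)⁻¹ = s at e
        have hsT : s ∈ T := hs ▸ hβy
        rw [map_mul, map_zpow, e, hTk t ht, (hcen t ht _).symm.mul_zpow, (hcen s hsT _).mul_zpow]
        have : s ^ i * (y ^ k) ^ i * t ^ k * ((y ^ i) ^ k * t ^ k)⁻¹ = s ^ i := by
          rw [← zpow_mul, ← zpow_mul, mul_comm i k]; group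
        rw [this]
        exact T.zpow_mem hsT i
      · intro w hw
        rw [hTk w hw, mul_inv_cancel]
        exact one_mem _
    · have hHpow : ∀ h ∈ T, h ^ p ∈ (⊥ : Subgroup G) := fun h hh => (hTfacts h hh).1
      have hHcomm : ∀ h ∈ T, ∀ g ∈ T, ⁅h, g⁆ ∈ (⊥ : Subgroup G) := fun h hh g _ =>
        commutatorElement_eq_one_iff_mul_comm.2 (hcen h hh g).eq
      have hsc : ∀ h ∈ T, β h * (h ^ k)⁻¹ ∈ (⊥ : Subgroup G) := fun h hh => by
        rw [hTk h hh, mul_inv_cancel]; exact one_mem _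
      refine hns ⊥ ⊥ T le_rfl bot_le ?_ ?_ hHpow hHcomm hsc ?_
      · intro h
        exact hDtop (eq_top_iff.2 (h ▸ hTD))
      · apply le_antisymm (relIndex_le h2 p hp _ _ hHpow hHcomm)
        rw [relIndex_bot_left]
        obtain ⟨n, hn⟩ := IsPGroup.iff_card.1 (hG.to_subgroup T)
        rw [hn] at hcard ⊢
        apply Nat.pow_le_pow_right hp.pos
        by_contra hlt
        apply hcard
        calc p ^ n ≤ p ^ 1 := Nat.pow_le_pow_right hp.pos (by omega)
          _ = p := pow_one p
      · intro w hw
        rw [mem_bot.1 hw]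
        simp
  · -- case `k² ≠ 1`
    have hexp : ∀ x : G, x ^ p = 1 := by
      intro x
      refine zpow_eq_one_of hp _ (hTfacts _ (hpowT x)).1 _ ?_ (hpk x)
      have hpp := Nat.prime_iff_prime_int.1 hp
      intro h
      rcases hpp.dvd_or_dvd h with h | h
      · exact hk0 h
      · rcases hpp.dvd_or_dvd h with h | h
        · exact hk1 h
        · exact hk2 h
    obtain ⟨x, hxD, hxT⟩ : ∃ x, x ∉ D ∧ ¬ T ≤ zpowers ⁅c, x⁆ := by
      by_cases hcard : Nat.card T ≤ p
      · obtain ⟨a, haD, hca⟩ := hE hcard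
        refine ⟨a, haD, ?_⟩
        rw [hca, zpowers_one_eq_bot, le_bot_iff]
        exact hTne
      · obtain ⟨x, hx⟩ : ∃ x, x ∉ D := by
          by_contra h
          push Not at h
          exact hDtop (eq_top_iff.2 fun y _ => h y)
        refine ⟨x, hx, fun h => hcard ?_⟩
        refine (card_le_of_le h).trans ?_
        rw [Nat.card_zpowers]
        exact orderOf_le_of_pow_eq_one hp.pos (hexp _)
    have hNT : zpowers ⁅c, x⁆ ≤ T := (zpowers_le).2 (hfx c hcD x)
    have hHcomm : ∀ h ∈ zpowers x ⊔ D, ∀ g ∈ zpowers x ⊔ D, ⁅h, g⁆ ∈ zpowers ⁅c, x⁆ := by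
      have hdec : ∀ h ∈ zpowers x ⊔ D, ∃ i : ℤ, ∃ t ∈ D, h = x ^ i * t := by
        intro f hf
        obtain ⟨z, hz, t, ht, rfl⟩ := mem_sup_of_normal_right.1 hf
        obtain ⟨i, rfl⟩ := mem_zpowers_iff.1 hz
        exact ⟨i, t, ht, rfl⟩
      have hfj : ∀ f ∈ D, ∀ j : ℤ, ⁅f, x ^ j⁆ ∈ zpowers ⁅c, x⁆ := by
        intro f hf j
        rw [comm_zpow_right _ _ (hcen _ (hfx f hf x) _)]
        apply zpow_mem
        obtain ⟨i, t, ht, rfl⟩ := hDz f hf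
        rw [comm_mul_left _ _ _ (hcen _ (hfx t (hTD ht) x) _),
          commutatorElement_eq_one_iff_mul_comm.2 (hcen t ht x).eq, one_mul,
          comm_zpow_left _ _ (hcen _ (hfx c hcD x) _)]
        exact zpow_mem (mem_zpowers _) i
      intro h hh g hg
      obtain ⟨i, f, hf, rfl⟩ := hdec h hh
      obtain ⟨j, e, he, rfl⟩ := hdec g hg
      rw [comm_mul_left _ _ _ (hcen _ (hfx f hf _) _),
        comm_mul_right _ _ _ (hcen _ (hfx f hf _) _),
        commutatorElement_eq_one_iff_mul_comm.2 (hDD f hf e he).eq, mul_one]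
      have h1 : ⁅x ^ i, e⁆ ∈ T := by
        rw [← commutatorElement_inv]
        exact inv_mem (hfx e he _)
      rw [comm_mul_right _ _ _ (hcen _ h1 _),
        commutatorElement_eq_one_iff_mul_comm.2 ((Commute.refl x).zpow_zpow i j).eq, one_mul,
        ← commutatorElement_inv e]
      exact mul_mem (hfj f hf j) (inv_mem (hfj e he i))
    have hle := relIndex_le h2 p hp (zpowers ⁅c, x⁆) (zpowers x ⊔ D)
      (fun h _ => by rw [hexp]; exact one_mem _) hHcomm
    rw [← relIndex_mul_relIndex _ D _ (hNT.trans hTD) le_sup_right,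
      ← relIndex_mul_relIndex _ T _ hNT hTD] at hle
    have i1 := le_relIndex hp hG _ _ hxT
    have i2 := le_relIndex hp hG _ _ hDT
    have i3 := le_relIndex hp hG D (zpowers x ⊔ D)
      (fun h => hxD (h (mem_sup_left (mem_zpowers x))))
    have := (Nat.mul_le_mul (Nat.mul_le_mul i1 i2) i3).trans hle
    have h3 : p ^ 2 * p ≤ p ^ 2 * 1 := by
      calc p ^ 2 * p = p * p * p := by ring
        _ ≤ _ := this
        _ = _ := by ring
    have := Nat.le_of_mul_le_mul_left h3 (pow_pos hp.pos 2)
    omega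

open Subgroup in
/-- If `(P, α)` is a maximal `(p,q)`-pair of rank `2` with `p > 3`, then `P` is
elementary abelian of order `p^2`, or non-abelian of order `p^3` and exponent `p`. -/
theorem stmt18 (p q : ℕ) (P : Type*) [Group P] (α : P ≃* P)
    (h : IsMaximalPair p q 2 P α) (hp : 3 < p) :
    (Nat.card P = p ^ 2 ∧ (∀ x y : P, x * y = y * x) ∧ (∀ x : P, x ^ p = 1)) ∨
    (Nat.card P = p ^ 3 ∧ ¬ (∀ x y : P, x * y = y * x) ∧ (∀ x : P, x ^ p = 1)) := by
  obtain ⟨hpp, hq, hfin, hP, hord, hqp, hd, hdle, ⟨k, hk1, hαk⟩, hmax⟩ := h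
  haveI := Fact.mk hpp
  set β : P →* P := α.toMonoidHom with hβdef
  have hβa : ∀ x, β x = α x := fun x => rfl
  have hβp : ∀ x, β^[p] x = β x := by
    have h1 : α ^ (p - 1) = 1 := orderOf_dvd_iff_pow_eq_one.1 (hord ▸ hqp)
    have h3 : α ^ p = α := by
      conv_lhs => rw [← Nat.sub_add_cancel hpp.one_le, pow_succ, h1, one_mul]
    intro x
    have h4 : ∀ n : ℕ, β^[n] x = (α ^ n) x := by
      intro n
      induction n with
      | zero => rfl
      | succ n ih => rw [Function.iterate_succ_apply', ih, pow_succ']; rfl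
    rw [h4, h3]; rfl
  have h2 : TwoGen P := twoGen_of hdle
  have hns : NoScalar p k β := noScalar_of α k hpp hP hk1 hβp hdle hmax
  have hΦ : ∀ K : Subgroup P, K ⊔ frattini P = ⊤ → K = ⊤ := fun K hK => frattini_nongenerating hK
  have hnc0 : ∀ x : P, zpowers x ⊔ frattini P ≠ ⊤ := by
    intro x hx
    have := dG_le_one x (hΦ _ hx)
    omega
  have hpowΦ : ∀ x : P, x ^ p ∈ frattini P := by
    intro x
    have : zpowers (x ^ p) ≤ frattini P :=
      le_iInf₂ fun K hK => (zpowers_le).2 ((coatom_props p hpp hP K hK).1 x)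
    exact this (mem_zpowers _)
  have hcomΦ : commutator P ≤ frattini P := by
    refine le_iInf₂ fun K hK => ?_
    rw [_root_.commutator_def, commutator_le]
    intro x _ y _
    exact (coatom_props p hpp hP K hK).2 x y
  have hk0 : ¬ (p : ℤ) ∣ k := by
    rintro ⟨m, rfl⟩
    apply hnc0 1
    rw [eq_top_iff]
    intro y _
    obtain ⟨x, rfl⟩ := α.surjective y
    have h1 := hαk x
    rw [zpow_mul, zpow_natCast] at h1
    have h3 := mul_mem h1 (zpow_mem (hpowΦ x) m)
    rw [inv_mul_cancel_right] at h3
    exact mem_sup_right h3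
  -- step 1
  have hpow : ∀ x : P, x ^ p ∈ commutator P := by
    let Q := Abelianization P
    let π : P →* Q := Abelianization.of
    have hπ : Function.Surjective π := QuotientGroup.mk'_surjective _
    have hker : ∀ x, π x = 1 ↔ x ∈ commutator P := fun x => QuotientGroup.eq_one_iff x
    haveI : Finite Q := Finite.of_surjective _ hπ
    let βQ : Q →* Q := Abelianization.map β
    have hβQ : ∀ x, βQ (π x) = π (β x) := fun x => rfl
    have hle : frattini P ≤ ((powMonoidHom p : Q →* Q).range).comap π := by
      apply frattini_le_of p hpp
      · intro x
        exact ⟨π x, by simp⟩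
      · intro x y
        refine ⟨1, ?_⟩
        have : π ⁅x, y⁆ = 1 := (hker _).2 (commutator_mem_commutator (mem_top x) (mem_top y))
        rw [this]; simp
    have := step1 (Q := Q) hpp (hP.of_surjective π hπ) k βQ (h2.of_surjective π hπ)
      (hns.of_surjective π hπ βQ hβQ) (by
        intro x hx
        obtain ⟨x, rfl⟩ := hπ x
        apply hnc0 x
        rw [eq_top_iff]
        intro y _
        have hy : π y ∈ zpowers (π x) ⊔ (powMonoidHom p : Q →* Q).range := hx ▸ mem_top _
        obtain ⟨s, hs, r, ⟨z, rfl⟩, hsr⟩ := mem_sup.1 hy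
        obtain ⟨i, rfl⟩ := mem_zpowers_iff.1 hs
        obtain ⟨z, rfl⟩ := hπ z
        rw [powMonoidHom_apply, ← map_pow, ← map_zpow, ← map_mul] at hsr
        have h3 : (x ^ i * z ^ p)⁻¹ * y ∈ commutator P := by
          rw [← hker, map_mul, map_inv, hsr, inv_mul_cancel]
        have h4 : y = x ^ i * z ^ p * ((x ^ i * z ^ p)⁻¹ * y) := by group
        rw [h4]
        exact mul_mem (mul_mem (mem_sup_left (zpow_mem (mem_zpowers x) i))
          (mem_sup_right (hpowΦ z))) (mem_sup_right (hcomΦ h3)))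
      (by
        intro x
        obtain ⟨x, rfl⟩ := hπ x
        rw [hβQ, ← map_zpow, ← map_inv, ← map_mul]
        exact hle (hαk x))
    intro x
    rw [← hker, map_pow]
    exact this _
  have hΦD : frattini P = commutator P := le_antisymm
    (frattini_le_of p hpp _ hpow
      (fun x y => commutator_mem_commutator (mem_top x) (mem_top y))) hcomΦ
  rw [hΦD] at hnc0 hαk
  have hidx : (commutator P).index = p ^ 2 := by
    have hle := relIndex_le h2 p hpp (commutator P) ⊤ (fun x _ => hpow x)
      (fun x _ y _ => commutator_mem_commutator (mem_top x) (mem_top y))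
    rw [relIndex_top_right] at hle
    apply le_antisymm hle
    obtain ⟨x, hx⟩ : ∃ x, x ∉ commutator P := by
      by_contra hh
      push Not at hh
      apply hnc0 1
      rw [eq_top_iff]
      exact fun y _ => mem_sup_right (hh y)
    rw [← relIndex_top_right, ← relIndex_mul_relIndex _ (zpowers x ⊔ commutator P) _
      le_sup_right le_top, sq]
    apply Nat.mul_le_mul
    · apply le_relIndex hpp hP
      exact fun hh => hx (hh (mem_sup_left (mem_zpowers x)))
    · apply le_relIndex hpp hP
      exact fun hh => hnc0 x (eq_top_iff.2 hh)
  obtain ⟨hpowT, -⟩ := step2' hpp k hk1 hk0 β hpow hαk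
  have hTD : ⁅commutator P, (⊤ : Subgroup P)⁆ ≤ commutator P := commutator_le_left _ _
  haveI hnil : Group.IsNilpotent P := hP.isNilpotent
  have hnil' : ∀ S : Subgroup P, S ≤ ⁅S, (⊤ : Subgroup P)⁆ → S = ⊥ := by
    intro S hS
    obtain ⟨n, hn⟩ := Subgroup.nilpotent_iff_lowerCentralSeries.1 hnil
    rw [eq_bot_iff, ← hn]
    clear hn
    induction n with
    | zero => exact le_top
    | succ n ih => exact hS.trans (commutator_mono ih le_rfl)
  -- step 3
  have hT : ⁅commutator P, (⊤ : Subgroup P)⁆ = ⊥ := by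
    by_contra hTne
    set T : Subgroup P := ⁅commutator P, (⊤ : Subgroup P)⁆ with hTdef
    set K : Subgroup P := ⁅T, (⊤ : Subgroup P)⁆ with hK
    haveI : T.Normal := by rw [hTdef]; infer_instance
    haveI : K.Normal := by rw [hK]; infer_instance
    have hKT : K ≤ T := commutator_le_left _ _
    let π : P →* P ⧸ K := QuotientGroup.mk' K
    have hπ : Function.Surjective π := QuotientGroup.mk'_surjective K
    have hker : ∀ x, π x = 1 ↔ x ∈ K := fun x => QuotientGroup.eq_one_iff x
    have hDβ : (commutator P).map β ≤ commutator P := by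
      rw [_root_.commutator_def, map_commutator]
      exact commutator_mono le_top le_top
    have hTβ : T.map β ≤ T := by
      rw [hTdef, map_commutator]
      exact commutator_mono hDβ le_top
    have hKβ : K ≤ K.comap β := by
      rw [← map_le_iff_le_comap, hK, map_commutator]
      exact commutator_mono hTβ le_top
    let βK : P ⧸ K →* P ⧸ K := QuotientGroup.map K K β hKβ
    have hβK : ∀ x, βK (π x) = π (β x) := fun x => rfl
    have hcom := map_commutator_top π hπ
    have hmapT : T.map π = ⁅commutator (P ⧸ K), (⊤ : Subgroup (P ⧸ K))⁆ := by
      rw [hTdef, map_commutator, hcom, ← MonoidHom.range_eq_map, MonoidHom.range_eq_top.2 hπ]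
    have hcomap : (commutator (P ⧸ K)).comap π = commutator P := by
      rw [← hcom, comap_map_eq, QuotientGroup.ker_mk', sup_eq_left]
      exact hKT.trans hTD
    refine step3 (G := P ⧸ K) hpp hp (hP.of_surjective π hπ) k hk1 hk0 βK
      (h2.of_surjective π hπ) (hns.of_surjective π hπ βK hβK) ?_ ?_ ?_ ?_ ?_ ?_
    · intro x
      obtain ⟨x, rfl⟩ := hπ x
      rw [← map_pow, ← hcom]
      exact ⟨_, hpow x, rfl⟩
    · intro x
      obtain ⟨x, rfl⟩ := hπ x
      rw [hβK, ← map_zpow, ← map_inv, ← map_mul, ← hcom]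
      exact ⟨_, hαk x, rfl⟩
    · intro x hx
      obtain ⟨x, rfl⟩ := hπ x
      apply hnc0 x
      have h3 : (zpowers x ⊔ commutator P).map π = ⊤ := by
        rw [Subgroup.map_sup, MonoidHom.map_zpowers, hcom, hx]
      have h4 := congrArg (comap π) h3
      rw [comap_map_eq, QuotientGroup.ker_mk', comap_top, sup_eq_left.2] at h4
      · exact h4
      · exact (hKT.trans hTD).trans le_sup_right
    · rw [← hidx, ← hcomap, index_comap_of_surjective _ hπ]
    · rw [← hmapT]
      rintro _ ⟨t, ht, rfl⟩
      rw [mem_center_iff]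
      intro g
      obtain ⟨g, rfl⟩ := hπ g
      symm
      rw [← commutatorElement_eq_one_iff_mul_comm, ← map_commutatorElement, hker]
      exact commutator_mem_commutator ht (mem_top g)
    · intro hb
      rw [← hmapT, Subgroup.map_eq_bot_iff, QuotientGroup.ker_mk'] at hb
      exact hTne (hnil' T hb)
  have hexp : ∀ x : P, x ^ p = 1 := by
    intro x
    have := hpowT x
    rw [hT, mem_bot] at this
    exact this
  have hcard := (commutator P).card_mul_index
  rw [hidx] at hcard
  by_cases hD : commutator P = ⊥
  · left
    refine ⟨?_, ?_, hexp⟩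
    · rw [← hcard, hD, card_bot, one_mul]
    · intro x y
      rw [← commutatorElement_eq_one_iff_mul_comm, ← mem_bot, ← hD]
      exact commutator_mem_commutator (mem_top x) (mem_top y)
  · right
    refine ⟨?_, ?_, hexp⟩
    · obtain ⟨a, b, hab⟩ := h2 ⊤
      have hle := commutator_le_pair a b hab.symm
      rw [hT, sup_bot_eq] at hle
      have h1 : Nat.card (commutator P) ≤ p := by
        refine (card_le_of_le hle).trans ?_
        rw [Nat.card_zpowers]
        exact orderOf_le_of_pow_eq_one hpp.pos (hexp _)
      have h3 : p ≤ Nat.card (commutator P) := by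
        rw [← relIndex_bot_left]
        exact le_relIndex hpp hP _ _ (fun hh => hD (eq_bot_iff.2 hh))
      rw [← hcard, le_antisymm h1 h3]
      ring
    · intro hc
      apply hD
      rw [eq_bot_iff, _root_.commutator_def, commutator_le]
      intro x _ y _
      rw [mem_bot, commutatorElement_eq_one_iff_mul_comm]
      exact hc x y
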